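/- For every k ≥ 1, |S_w(k) − b^{|w|} log b| ≤ (b−1) b^{|w| − max(k,2) + 1}. In particular S_w(k) → b^{|w|} log b as k → ∞. -/

import Mathlib

open scoped BigOperators
open Filter

/-- Number of (possibly overlapping) occurrences of the block `w` in `X`. -/
def occCount {α : Type*} [DecidableEq α] (w X : List α) : ℕ :=
  ((List.range X.length).filter fun i => (X.drop i).take w.length = w).length

/-- `S_w(k) = Σ 1/m` over positive integers `m` whose minimal base-`b` representation
contains exactly `k` occurrences of `w`. -/
noncomputable def Sw (b : ℕ) (w : List (Fin b)) (k : ℕ) : ℝ :=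
  ∑' m : ℕ,
    if m ≠ 0 ∧ occCount (w.map Fin.val) (Nat.digits b m).reverse = k then (m : ℝ)⁻¹ else 0

section Occurrences

variable {α : Type*} [DecidableEq α]

theorem occCount_le_length (w X : List α) : occCount w X ≤ X.length := by
  simpa [occCount] using
    List.length_filter_le (fun i => (X.drop i).take w.length = w) (List.range X.length)

theorem occCount_cons (w X : List α) (a : α) :
    occCount w (a :: X) = (if w <+: a :: X then 1 else 0) + occCount w X := by
  have h : w <+: a :: X ↔ (a :: X).take w.length = w := by
    rw [List.prefix_iff_eq_take, eq_comm]
  unfold occCount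
  rw [List.length_cons, List.range_succ_eq_map, List.filter_cons, List.filter_map]
  by_cases hp : w <+: a :: X
  · simp [hp, h.1 hp, Function.comp_def, add_comm]
  · have h' := mt h.2 hp
    simp [hp, h', Function.comp_def]

theorem occCount_concat (w X : List α) (d : α) :
    occCount w (X ++ [d]) = occCount w X + if w <:+ X ++ [d] then 1 else 0 := by
  induction X with
  | nil =>
    have h : w <+: [d] ↔ w <:+ [d] := by
      rw [show [d] = [] ++ [d] from rfl, List.prefix_concat_iff, List.nil_append,
        List.suffix_cons_iff]
      simp
    rw [List.nil_append, occCount_cons]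
    simp [h, add_comm]
  | cons a X ih =>
    rw [List.cons_append, occCount_cons, ih, occCount_cons, ← List.cons_append,
      if_congr List.prefix_concat_iff rfl rfl]
    have hs : w <:+ a :: X ++ [d] ↔ w = a :: X ++ [d] ∨ w <:+ X ++ [d] := by
      rw [List.cons_append, List.suffix_cons_iff]
    rw [if_congr hs rfl rfl]
    by_cases he : w = a :: X ++ [d]
    · have h1 : ¬ w <+: a :: X := fun h => by have := h.length_le; simp [he] at this
      have h2 : ¬ w <:+ X ++ [d] := fun h => by have := h.length_le; simp [he] at this
      simp only [he, true_or, if_true]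
      rw [← he, if_neg h1, if_neg h2]
      omega
    · simp only [he, false_or]
      omega

/-- Combined stakes of the gamblers who successively bet on `w` in the fair casino emitting the
letters of `X`: each matching prefix of `w` of length `i` at the end of `X` counts `b ^ i`. -/
noncomputable def borderWeight (b : ℕ) (w X : List α) : ℝ :=
  ∑ i ∈ Finset.range w.length, if w.take (i + 1) <:+ X then (b : ℝ) ^ (i + 1) else 0

theorem borderWeight_nonneg (b : ℕ) (w X : List α) : 0 ≤ borderWeight b w X :=
  Finset.sum_nonneg fun i _ => by split_ifs <;> positivity

theorem borderWeight_le (b : ℕ) (w X : List α) :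
    borderWeight b w X ≤ ∑ i ∈ Finset.range w.length, (b : ℝ) ^ (i + 1) :=
  Finset.sum_le_sum fun i _ => by split_ifs; exacts [le_rfl, by positivity]

theorem borderWeight_of_suffix (b : ℕ) {w X : List α} (h : w <:+ X) :
    borderWeight b w X = borderWeight b w w := by
  refine Finset.sum_congr rfl fun i _ => if_congr ⟨fun h' => ?_, fun h' => h'.trans h⟩ rfl rfl
  exact List.suffix_of_suffix_length_le h' h (by simp)

theorem sum_borderWeight_concat {b : ℕ} {w : List ℕ} (hw : ∀ a ∈ w, a < b) (X : List ℕ) :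
    ∑ d ∈ Finset.range b, borderWeight b w (X ++ [d]) =
      b * (1 + borderWeight b w X - if w <:+ X then (b : ℝ) ^ w.length else 0) := by
  have step : ∀ i ∈ Finset.range w.length,
      (∑ d ∈ Finset.range b, if w.take (i + 1) <:+ X ++ [d] then (b : ℝ) ^ (i + 1) else 0) =
        b * if w.take i <:+ X then (b : ℝ) ^ i else 0 := by
    intro i hi
    rw [Finset.mem_range] at hi
    have hiff : ∀ d, w.take (i + 1) <:+ X ++ [d] ↔ w.take i <:+ X ∧ w[i] = d := by
      intro d
      rw [← List.take_append_getElem hi, List.suffix_append_inj_of_length_eq (by simp)]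
      simp
    have hmem : w[i] ∈ Finset.range b := Finset.mem_range.2 (hw _ (List.getElem_mem hi))
    simp only [hiff]
    by_cases hX : w.take i <:+ X
    · simp only [hX, true_and, if_true]
      rw [Finset.sum_ite_eq, if_pos hmem, pow_succ']
    · simp [hX]
  have shift : (∑ i ∈ Finset.range w.length, if w.take i <:+ X then (b : ℝ) ^ i else 0) +
      (if w <:+ X then (b : ℝ) ^ w.length else 0) = borderWeight b w X + 1 := by
    have h := Finset.sum_range_succ (fun i => if w.take i <:+ X then (b : ℝ) ^ i else 0) w.length
    rw [Finset.sum_range_succ'] at h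
    simpa [borderWeight] using h.symm
  unfold borderWeight at shift ⊢
  rw [Finset.sum_comm, Finset.sum_congr rfl step, ← Finset.mul_sum]
  congr 1
  linarith

/-- Expected number of times at which the word obtained from `X` by appending uniform random
base-`b` digits has exactly `k` occurrences of `w`. -/
noncomputable def occPotential (b : ℕ) (w : List α) (k : ℕ) (X : List α) : ℝ :=
  if occCount w X < k then (b : ℝ) ^ w.length
  else if occCount w X = k then
    borderWeight b w w - borderWeight b w X + if w <:+ X then (b : ℝ) ^ w.length else 0
  else 0

theorem occPotential_eq_pow {b k : ℕ} {w X : List α} (hX : X.length = k)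
    (hk : 1 ≤ k) : occPotential b w k X = (b : ℝ) ^ w.length := by
  unfold occPotential
  split_ifs with h1 h2 h3
  · rfl
  · rw [borderWeight_of_suffix b h3]; ring
  · exfalso
    rcases List.eq_nil_or_concat' X with rfl | ⟨Y, d, rfl⟩
    · simp at hX; omega
    · rw [occCount_concat, if_neg h3] at h2
      have := occCount_le_length w Y
      simp at hX
      omega
  · have := occCount_le_length w X
    omega

theorem abs_occPotential_le (b : ℕ) (w : List α) (k : ℕ) (X : List α) :
    |occPotential b w k X| ≤
      ((∑ i ∈ Finset.range w.length, (b : ℝ) ^ (i + 1)) + (b : ℝ) ^ w.length) *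
        ∑ i ∈ Finset.range (k + 1), if occCount w X = i then 1 else 0 := by
  have h1 := borderWeight_nonneg b w X
  have h2 := borderWeight_le b w X
  have h3 := borderWeight_nonneg b w w
  have h4 := borderWeight_le b w w
  have h5 : (0 : ℝ) ≤ (b : ℝ) ^ w.length := by positivity
  rw [Finset.sum_ite_eq]
  unfold occPotential
  simp only [Finset.mem_range]
  rcases lt_trichotomy (occCount w X) k with h | h | h
  · rw [if_pos h, if_pos (by omega), abs_le]
    constructor <;> linarith
  · rw [if_neg h.not_lt, if_pos h, if_pos (show occCount w X < k + 1 by omega), abs_le]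
    split_ifs <;> constructor <;> linarith
  · rw [if_neg (by omega), if_neg (by omega), if_neg (by omega)]
    simp

theorem sum_occPotential_concat {b : ℕ} {w : List ℕ}
    (hwb : ∀ a ∈ w, a < b) (k : ℕ) (X : List ℕ) :
    ∑ d ∈ Finset.range b, occPotential b w k (X ++ [d]) =
      b * (occPotential b w k X - if occCount w X = k then 1 else 0) := by
  rcases lt_trichotomy (occCount w X) k with h | h | h
  · have hd : ∀ d ∈ Finset.range b, occPotential b w k (X ++ [d]) = (b : ℝ) ^ w.length := by
      intro d _
      unfold occPotential
      rw [occCount_concat]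
      split_ifs with hs
      · rfl
      · rw [borderWeight_of_suffix b hs]; ring
      all_goals first | rfl | omega
    rw [Finset.sum_congr rfl hd]
    simp [occPotential, h, h.ne]
  · have hd : ∀ d ∈ Finset.range b, occPotential b w k (X ++ [d]) =
        borderWeight b w w - borderWeight b w (X ++ [d]) := by
      intro d _
      unfold occPotential
      rw [occCount_concat]
      by_cases hs : w <:+ X ++ [d]
      · rw [borderWeight_of_suffix b hs]
        simp [hs, h]
      · simp [hs, h]
    rw [Finset.sum_congr rfl hd, Finset.sum_sub_distrib, sum_borderWeight_concat hwb]
    simp only [occPotential, h, lt_irrefl, if_true, if_false, Finset.sum_const,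
      Finset.card_range, nsmul_eq_mul]
    ring
  · have hd : ∀ d ∈ Finset.range b, occPotential b w k (X ++ [d]) = 0 := by
      intro d _
      unfold occPotential
      rw [occCount_concat, if_neg (by omega), if_neg (by omega)]
    rw [Finset.sum_congr rfl hd]
    simp [occPotential, h.ne', h.not_gt]

end Occurrences

section BlockMean

/-- Mean of `f` over the integers whose base-`b` representation is that of `n` followed by `j`
arbitrary digits. -/
noncomputable def blockMean (b j : ℕ) (f : ℕ → ℝ) (n : ℕ) : ℝ :=
  ((b : ℝ) ^ j)⁻¹ * ∑ r ∈ Finset.range (b ^ j), f (n * b ^ j + r)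

theorem sum_range_mul_eq_sum_blocks (f : ℕ → ℝ) (a c : ℕ) :
    ∑ m ∈ Finset.range (a * c), f m =
      ∑ n ∈ Finset.range a, ∑ r ∈ Finset.range c, f (n * c + r) := by
  induction a with
  | zero => simp
  | succ a ih => rw [add_mul, one_mul, Finset.sum_range_add, ih, Finset.sum_range_succ]

theorem blockMean_zero (b : ℕ) (f : ℕ → ℝ) (n : ℕ) : blockMean b 0 f n = f n := by
  simp [blockMean]

theorem blockMean_succ (b j : ℕ) (f : ℕ → ℝ) (n : ℕ) :
    blockMean b (j + 1) f n = blockMean b j (blockMean b 1 f) n := by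
  have h := sum_range_mul_eq_sum_blocks (fun s => f (n * b ^ (j + 1) + s)) (b ^ j) b
  rw [← pow_succ] at h
  unfold blockMean
  rw [h, ← Finset.mul_sum, ← mul_assoc, pow_one, ← mul_inv, ← pow_succ]
  congr 1
  refine Finset.sum_congr rfl fun i _ => ?_
  rw [pow_one]
  refine Finset.sum_congr rfl fun r _ => ?_
  congr 1
  ring

theorem blockMean_congr {b j n : ℕ} (hb : 0 < b) (hn : 1 ≤ n) {f g : ℕ → ℝ}
    (h : ∀ m, 1 ≤ m → f m = g m) : blockMean b j f n = blockMean b j g n := by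
  unfold blockMean
  congr 1
  refine Finset.sum_congr rfl fun r _ => h _ ?_
  have := Nat.mul_pos hn (pow_pos hb j)
  omega

theorem blockMean_sub (b j : ℕ) (f g : ℕ → ℝ) (n : ℕ) :
    blockMean b j (fun m => f m - g m) n = blockMean b j f n - blockMean b j g n := by
  simp only [blockMean, Finset.sum_sub_distrib, mul_sub]

theorem blockMean_nonneg {b j n : ℕ} {f : ℕ → ℝ} (h : ∀ m, 0 ≤ f m) : 0 ≤ blockMean b j f n :=
  mul_nonneg (by positivity) (Finset.sum_nonneg fun _ _ => h _)

theorem abs_blockMean_le_of_abs_le {b j n : ℕ} {f g : ℕ → ℝ} (h : ∀ m, |f m| ≤ g m) :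
    |blockMean b j f n| ≤ blockMean b j g n := by
  unfold blockMean
  rw [abs_mul, abs_of_nonneg (by positivity : (0 : ℝ) ≤ ((b : ℝ) ^ j)⁻¹)]
  gcongr
  exact (Finset.abs_sum_le_sum_abs _ _).trans (Finset.sum_le_sum fun _ _ => h _)

theorem blockMean_const_mul_sum (b j n K : ℕ) (C : ℝ) (f : ℕ → ℕ → ℝ) :
    blockMean b j (fun m => C * ∑ i ∈ Finset.range K, f i m) n =
      C * ∑ i ∈ Finset.range K, blockMean b j (f i) n := by
  simp only [blockMean, ← Finset.mul_sum]
  rw [Finset.sum_comm]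
  ring

theorem sum_blockMean_eq_sub {b n : ℕ} (hb : 0 < b) (hn : 1 ≤ n) {u G : ℕ → ℝ}
    (h : ∀ m, 1 ≤ m → blockMean b 1 G m = G m - u m) (J : ℕ) :
    ∑ j ∈ Finset.range J, blockMean b j u n = G n - blockMean b J G n := by
  induction J with
  | zero => simp [blockMean_zero]
  | succ J ih =>
    rw [Finset.sum_range_succ, ih, blockMean_succ, blockMean_congr hb hn h, blockMean_sub]
    ring

end BlockMean

/-- Indicator of the integers with exactly `k` occurrences of `w` in base `b`. -/
noncomputable def occIndicator (b : ℕ) (w : List ℕ) (k m : ℕ) : ℝ :=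
  if occCount w (Nat.digits b m).reverse = k then 1 else 0

theorem occIndicator_nonneg (b : ℕ) (w : List ℕ) (k m : ℕ) : 0 ≤ occIndicator b w k m := by
  unfold occIndicator; split_ifs <;> norm_num

theorem reverse_digits_mul_add {b m d : ℕ} (hb : 1 < b) (hm : 1 ≤ m) (hd : d < b) :
    (Nat.digits b (m * b + d)).reverse = (Nat.digits b m).reverse ++ [d] := by
  rw [mul_comm, add_comm, Nat.digits_add b hb d m hd (Or.inr (by omega)), List.reverse_cons]

theorem blockMean_one_occPotential {b : ℕ} (hb : 1 < b) {w : List ℕ}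
    (hwb : ∀ a ∈ w, a < b) (k m : ℕ) (hm : 1 ≤ m) :
    blockMean b 1 (fun n => occPotential b w k (Nat.digits b n).reverse) m =
      occPotential b w k (Nat.digits b m).reverse - occIndicator b w k m := by
  have hb0 : (b : ℝ) ≠ 0 := by positivity
  unfold blockMean
  have hdigits : ∀ d ∈ Finset.range b, occPotential b w k (Nat.digits b (m * b + d)).reverse =
      occPotential b w k ((Nat.digits b m).reverse ++ [d]) := fun d hd => by
    rw [reverse_digits_mul_add hb hm (Finset.mem_range.1 hd)]
  rw [pow_one, pow_one, Finset.sum_congr rfl hdigits, sum_occPotential_concat hwb, inv_mul_cancel_left₀ hb0, occIndicator]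

theorem abs_blockMean_occPotential_le (b : ℕ) (w : List ℕ) (k j n : ℕ) :
    |blockMean b j (fun m => occPotential b w k (Nat.digits b m).reverse) n| ≤
      ((∑ i ∈ Finset.range w.length, (b : ℝ) ^ (i + 1)) + (b : ℝ) ^ w.length) *
        ∑ i ∈ Finset.range (k + 1), blockMean b j (occIndicator b w i) n := by
  rw [← blockMean_const_mul_sum]
  exact abs_blockMean_le_of_abs_le fun m => abs_occPotential_le b w k _

theorem abs_occPotential_le_const (b : ℕ) (w : List ℕ) (k : ℕ) (X : List ℕ) :
    |occPotential b w k X| ≤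
      (∑ i ∈ Finset.range w.length, (b : ℝ) ^ (i + 1)) + (b : ℝ) ^ w.length := by
  refine (abs_occPotential_le b w k X).trans (mul_le_of_le_one_right (by positivity) ?_)
  rw [Finset.sum_ite_eq]
  split_ifs <;> norm_num

theorem summable_blockMean_occIndicator {b : ℕ} (hb : 1 < b) {w : List ℕ}
    (hwb : ∀ a ∈ w, a < b) (k n : ℕ) (hn : 1 ≤ n) :
    Summable fun j => blockMean b j (occIndicator b w k) n := by
  set C := (∑ i ∈ Finset.range w.length, (b : ℝ) ^ (i + 1)) + (b : ℝ) ^ w.length with hC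
  refine summable_of_sum_range_le (c := C + C)
    (fun j => blockMean_nonneg (occIndicator_nonneg b w k)) fun J => ?_
  rw [sum_blockMean_eq_sub (by omega) hn (blockMean_one_occPotential hb hwb k)]
  have h1 := abs_le.1 (abs_occPotential_le_const b w k (Nat.digits b n).reverse)
  have h2 : |blockMean b J (fun m => occPotential b w k (Nat.digits b m).reverse) n| ≤
      blockMean b J (fun _ => C) n :=
    abs_blockMean_le_of_abs_le fun m => abs_occPotential_le_const b w k _
  have h3 : blockMean b J (fun _ => C) n = C := by
    have : (b : ℝ) ≠ 0 := by positivity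
    simp [blockMean, this]
  rw [h3] at h2
  have h4 := abs_le.1 h2
  linarith [h1.2, h4.1]

theorem hasSum_blockMean_occIndicator {b : ℕ} (hb : 1 < b) {w : List ℕ}
    (hwb : ∀ a ∈ w, a < b) (k n : ℕ) (hn : 1 ≤ n) :
    HasSum (fun j => blockMean b j (occIndicator b w k) n)
      (occPotential b w k (Nat.digits b n).reverse) := by
  rw [(summable_blockMean_occIndicator hb hwb k n hn).hasSum_iff_tendsto_nat]
  simp only [sum_blockMean_eq_sub (by omega) hn (blockMean_one_occPotential hb hwb k)]
  have hlim : Tendsto (fun j =>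
      ((∑ i ∈ Finset.range w.length, (b : ℝ) ^ (i + 1)) + (b : ℝ) ^ w.length) *
        ∑ i ∈ Finset.range (k + 1), blockMean b j (occIndicator b w i) n) atTop (nhds 0) := by
    simpa using (tendsto_finsetSum (Finset.range (k + 1)) fun i _ =>
      (summable_blockMean_occIndicator hb hwb i n hn).tendsto_atTop_zero).const_mul
        ((∑ i ∈ Finset.range w.length, (b : ℝ) ^ (i + 1)) + (b : ℝ) ^ w.length)
  have h0 := squeeze_zero_norm
    (fun j => (Real.norm_eq_abs _).trans_le (abs_blockMean_occPotential_le b w k j n)) hlim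
  simpa using h0.const_sub (occPotential b w k (Nat.digits b n).reverse)

theorem sum_block_inv_bounds {b n : ℕ} (hb : 0 < b) (hn : 1 ≤ n) {u : ℕ → ℝ}
    (hu : ∀ m, 0 ≤ u m) (j : ℕ) :
    ((n : ℝ) + 1)⁻¹ * blockMean b j u n ≤
        ∑ r ∈ Finset.range (b ^ j), u (n * b ^ j + r) * ((n * b ^ j + r : ℕ) : ℝ)⁻¹ ∧
      ∑ r ∈ Finset.range (b ^ j), u (n * b ^ j + r) * ((n * b ^ j + r : ℕ) : ℝ)⁻¹ ≤
        (n : ℝ)⁻¹ * blockMean b j u n := by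
  have hc : (0 : ℝ) < (b : ℝ) ^ j := by positivity
  have hn' : (0 : ℝ) < n := by exact_mod_cast hn
  unfold blockMean
  rw [← mul_assoc, ← mul_assoc, ← mul_inv, ← mul_inv, Finset.mul_sum, Finset.mul_sum]
  constructor <;> refine Finset.sum_le_sum fun r hr => ?_
  · have hr' : (r : ℝ) ≤ (b : ℝ) ^ j := by exact_mod_cast (Finset.mem_range.1 hr).le
    rw [mul_comm]
    refine mul_le_mul_of_nonneg_left (inv_anti₀ ?_ ?_) (hu _)
    · push_cast; positivity
    · push_cast; linarith
  · rw [mul_comm (_⁻¹)]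
    refine mul_le_mul_of_nonneg_left (inv_anti₀ (by positivity) ?_) (hu _)
    push_cast
    linarith [(Nat.cast_nonneg r : (0 : ℝ) ≤ r)]

theorem sum_range_mul_pow_eq_sum_blocks {b N : ℕ} (hb : 0 < b) {g : ℕ → ℝ}
    (hg : ∀ m < N, g m = 0) (J : ℕ) :
    ∑ m ∈ Finset.range (N * b ^ J), g m =
      ∑ n ∈ Finset.Ico N (N * b), ∑ j ∈ Finset.range J,
        ∑ r ∈ Finset.range (b ^ j), g (n * b ^ j + r) := by
  induction J with
  | zero =>
    simpa using Finset.sum_eq_zero fun m hm => hg m (Finset.mem_range.1 hm)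
  | succ J ih =>
    simp only [Finset.sum_range_succ, Finset.sum_add_distrib]
    rw [← ih, Finset.sum_Ico_eq_sub _ (Nat.le_mul_of_pos_right N hb),
      ← sum_range_mul_eq_sum_blocks, ← sum_range_mul_eq_sum_blocks,
      show N * b ^ (J + 1) = N * b * b ^ J by ring]
    ring

/-- A sum of `u m / m` is controlled by Riemann sums when `u` has constant total mass `c` over the
descendants of each integer in `[N, N * b)`. -/
theorem tsum_mul_inv_bounds {b N : ℕ} (hb : 1 < b) (hN : 1 ≤ N) {u : ℕ → ℝ} {c : ℝ}
    (hu : ∀ m, 0 ≤ u m) (hu0 : ∀ m < N, u m = 0)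
    (hsum : ∀ n ∈ Finset.Ico N (N * b), HasSum (fun j => blockMean b j u n) c) :
    c * ∑ n ∈ Finset.Ico N (N * b), ((n : ℝ) + 1)⁻¹ ≤ ∑' m : ℕ, u m * (m : ℝ)⁻¹ ∧
      ∑' m : ℕ, u m * (m : ℝ)⁻¹ ≤ c * ∑ n ∈ Finset.Ico N (N * b), (n : ℝ)⁻¹ := by
  have hb0 : 0 < b := by omega
  have hg : ∀ m, 0 ≤ u m * (m : ℝ)⁻¹ := fun m => mul_nonneg (hu m) (by positivity)
  have hdecomp := sum_range_mul_pow_eq_sum_blocks (N := N) (g := fun m => u m * (m : ℝ)⁻¹) hb0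
    (fun m hm => by simp [hu0 m hm])
  have hpos : ∀ n ∈ Finset.Ico N (N * b), 1 ≤ n := fun n hn =>
    hN.trans (Finset.mem_Ico.1 hn).1
  have hupper : ∀ J, ∑ m ∈ Finset.range (N * b ^ J), u m * (m : ℝ)⁻¹ ≤
      c * ∑ n ∈ Finset.Ico N (N * b), (n : ℝ)⁻¹ := by
    intro J
    rw [hdecomp, Finset.mul_sum]
    refine Finset.sum_le_sum fun n hn => ?_
    calc _ ≤ ∑ j ∈ Finset.range J, (n : ℝ)⁻¹ * blockMean b j u n :=
          Finset.sum_le_sum fun j _ => (sum_block_inv_bounds hb0 (hpos n hn) hu j).2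
      _ = (n : ℝ)⁻¹ * ∑ j ∈ Finset.range J, blockMean b j u n := by rw [Finset.mul_sum]
      _ ≤ (n : ℝ)⁻¹ * c := by
          gcongr
          exact sum_le_hasSum _ (fun j _ => blockMean_nonneg hu) (hsum n hn)
      _ = c * (n : ℝ)⁻¹ := mul_comm _ _
  have hlower : ∀ J, ∑ n ∈ Finset.Ico N (N * b),
      ((n : ℝ) + 1)⁻¹ * ∑ j ∈ Finset.range J, blockMean b j u n ≤
        ∑ m ∈ Finset.range (N * b ^ J), u m * (m : ℝ)⁻¹ := by
    intro J
    rw [hdecomp]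
    refine Finset.sum_le_sum fun n hn => ?_
    rw [Finset.mul_sum]
    exact Finset.sum_le_sum fun j _ => (sum_block_inv_bounds hb0 (hpos n hn) hu j).1
  have hsub : ∀ J, J ≤ N * b ^ J := fun J =>
    (Nat.lt_pow_self hb).le.trans (Nat.le_mul_of_pos_left _ hN)
  have hsummable : Summable fun m : ℕ => u m * (m : ℝ)⁻¹ :=
    summable_of_sum_range_le hg fun J =>
      (Finset.sum_le_sum_of_subset_of_nonneg (Finset.range_mono (hsub J))
        fun m _ _ => hg m).trans (hupper J)
  have hlim := hsummable.hasSum.tendsto_sum_nat.comp (tendsto_atTop_mono hsub tendsto_id)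
  refine ⟨?_, le_of_tendsto' hlim hupper⟩
  refine le_of_tendsto_of_tendsto' ?_ hlim hlower
  rw [mul_comm c, Finset.sum_mul]
  exact tendsto_finsetSum _ fun n hn => (hsum n hn).tendsto_sum_nat.const_mul _

theorem log_div_eq_sum_Ico {N M : ℕ} (hN : 1 ≤ N) (hNM : N ≤ M) :
    Real.log M - Real.log N = ∑ n ∈ Finset.Ico N M, Real.log (((n : ℝ) + 1) / n) := by
  have h : ∀ n ∈ Finset.Ico N M,
      Real.log (((n : ℝ) + 1) / n) = Real.log ((n + 1 : ℕ) : ℝ) - Real.log n := by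
    intro n hn
    have : (0 : ℝ) < n := by exact_mod_cast hN.trans (Finset.mem_Ico.1 hn).1
    rw [Real.log_div (by positivity) (by positivity)]
    push_cast
    rfl
  rw [Finset.sum_congr rfl h, Finset.sum_Ico_sub (fun n : ℕ => Real.log (n : ℝ)) hNM]

theorem log_sub_log_bounds {N M : ℕ} (hN : 1 ≤ N) (hNM : N ≤ M) :
    ∑ n ∈ Finset.Ico N M, ((n : ℝ) + 1)⁻¹ ≤ Real.log M - Real.log N ∧
      Real.log M - Real.log N ≤ ∑ n ∈ Finset.Ico N M, (n : ℝ)⁻¹ := by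
  rw [log_div_eq_sum_Ico hN hNM]
  constructor <;> refine Finset.sum_le_sum fun n hn => ?_
  all_goals
    have hn : (0 : ℝ) < n := by exact_mod_cast hN.trans (Finset.mem_Ico.1 hn).1
  · refine le_trans (le_of_eq ?_) (Real.one_sub_inv_le_log_of_pos (by positivity))
    field_simp
    ring
  · refine (Real.log_le_sub_one_of_pos (by positivity)).trans (le_of_eq ?_)
    field_simp
    ring

theorem sum_Ico_inv_sub_inv {N M : ℕ} (hNM : N ≤ M) :
    ∑ n ∈ Finset.Ico N M, (n : ℝ)⁻¹ - ∑ n ∈ Finset.Ico N M, ((n : ℝ) + 1)⁻¹ =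
      (N : ℝ)⁻¹ - (M : ℝ)⁻¹ := by
  have h := Finset.sum_Ico_sub (fun n : ℕ => (n : ℝ)⁻¹) hNM
  rw [Finset.sum_sub_distrib] at h
  push_cast at h
  linarith

theorem abs_Sw_sub_le {b : ℕ} (hb : 1 < b) (w : List (Fin b)) {k : ℕ}
    (hk : 1 ≤ k) :
    |Sw b w k - (b : ℝ) ^ w.length * Real.log b| ≤
      ((b : ℝ) - 1) * (b : ℝ) ^ ((w.length : ℤ) - k) := by
  obtain ⟨l, rfl⟩ : ∃ l, k = l + 1 := ⟨k - 1, by omega⟩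
  have hb0 : (0 : ℝ) < b := by positivity
  have hvb : ∀ a ∈ w.map Fin.val, a < b := by
    intro a ha
    obtain ⟨x, -, rfl⟩ := List.mem_map.1 ha
    exact x.2
  have hN : 1 ≤ b ^ l := Nat.one_le_pow _ _ (by omega)
  have hNM : b ^ l ≤ b ^ l * b := Nat.le_mul_of_pos_right _ (by omega)
  have hSw : Sw b w (l + 1) =
      ∑' m : ℕ, occIndicator b (w.map Fin.val) (l + 1) m * (m : ℝ)⁻¹ := by
    refine tsum_congr fun m => ?_
    by_cases hm : m = 0 <;> simp [hm, occIndicator]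
  have hzero : ∀ m < b ^ l, occIndicator b (w.map Fin.val) (l + 1) m = 0 := by
    intro m hm
    have h1 := (Nat.digits_length_le_iff hb m).2 hm
    have h2 := occCount_le_length (w.map Fin.val) (Nat.digits b m).reverse
    rw [List.length_reverse] at h2
    exact if_neg (by omega)
  have hmass : ∀ n ∈ Finset.Ico (b ^ l) (b ^ l * b), HasSum
      (fun j => blockMean b j (occIndicator b (w.map Fin.val) (l + 1)) n)
      ((b : ℝ) ^ w.length) := by
    intro n hn
    obtain ⟨h1, h2⟩ := Finset.mem_Ico.1 hn
    have h := hasSum_blockMean_occIndicator hb hvb (l + 1) n (hN.trans h1)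
    have hlen : (Nat.digits b n).reverse.length = l + 1 := by
      rw [List.length_reverse]
      exact le_antisymm ((Nat.digits_length_le_iff hb n).2 (by rwa [pow_succ]))
        ((Nat.lt_digits_length_iff hb n).2 h1)
    rwa [occPotential_eq_pow hlen hk, List.length_map] at h
  obtain ⟨hlow, hup⟩ := tsum_mul_inv_bounds hb hN (occIndicator_nonneg b _ (l + 1)) hzero hmass
  obtain ⟨hloglow, hlogup⟩ := log_sub_log_bounds hN hNM
  have hlog : Real.log ((b ^ l * b : ℕ) : ℝ) - Real.log ((b ^ l : ℕ) : ℝ) = Real.log b := by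
    push_cast
    rw [Real.log_mul (by positivity) (by positivity)]
    ring
  rw [hlog] at hloglow hlogup
  have hwidth := sum_Ico_inv_sub_inv hNM
  have hp : (0 : ℝ) ≤ (b : ℝ) ^ w.length := by positivity
  have hfinal : ((b : ℝ) - 1) * (b : ℝ) ^ ((w.length : ℤ) - ((l + 1 : ℕ) : ℤ)) =
      (b : ℝ) ^ w.length * (((b ^ l : ℕ) : ℝ)⁻¹ - ((b ^ l * b : ℕ) : ℝ)⁻¹) := by
    rw [zpow_sub₀ hb0.ne', zpow_natCast, zpow_natCast, pow_succ]
    push_cast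
    field_simp
  rw [hfinal, hSw, ← hwidth, mul_sub, abs_le]
  have h1 := mul_le_mul_of_nonneg_left hloglow hp
  have h2 := mul_le_mul_of_nonneg_left hlogup hp
  constructor <;> linarith

/-- For every `k ≥ 1`, `|S_w(k) − b^{|w|} log b| ≤ (b−1) b^{|w| − max(k,2) + 1}`;
in particular `S_w(k) → b^{|w|} log b` as `k → ∞`. -/
theorem stmt19 (b : ℕ) (hb : 1 < b) (w : List (Fin b)) (hw : 1 ≤ w.length) :
    (∀ k : ℕ, 1 ≤ k →
      |Sw b w k - (b : ℝ) ^ w.length * Real.log b| ≤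
        ((b : ℝ) - 1) * (b : ℝ) ^ ((w.length : ℤ) - (max k 2 : ℤ) + 1)) ∧
    Tendsto (fun k => Sw b w k) atTop (nhds ((b : ℝ) ^ w.length * Real.log b)) := by
  have hb1 : (1 : ℝ) < b := by exact_mod_cast hb
  refine ⟨fun k hk => (abs_Sw_sub_le hb w hk).trans ?_, ?_⟩
  · refine mul_le_mul_of_nonneg_left (zpow_le_zpow_right₀ hb1.le ?_) (by linarith)
    omega
  · rw [tendsto_iff_norm_sub_tendsto_zero]
    have hlim : Tendsto (fun k : ℕ => ((b : ℝ) - 1) * (b : ℝ) ^ w.length * (b : ℝ)⁻¹ ^ k)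
        atTop (nhds 0) := by
      simpa using (tendsto_pow_atTop_nhds_zero_of_lt_one (by positivity)
        (inv_lt_one_of_one_lt₀ hb1)).const_mul (((b : ℝ) - 1) * (b : ℝ) ^ w.length)
    refine squeeze_zero' (Eventually.of_forall fun k => norm_nonneg _) ?_ hlim
    filter_upwards [eventually_ge_atTop 1] with k hk
    refine (abs_Sw_sub_le hb w hk).trans (le_of_eq ?_)
    rw [zpow_sub₀ (by positivity), zpow_natCast, zpow_natCast, inv_pow, div_eq_mul_inv, mul_assoc]
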